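/- Let M be a left R-module and let (M_n)_{n∈ℕ} be an increasing chain of submodules of M with ⋃_{n∈ℕ} M_n = M. If M_n is *-acyclic for every n ∈ ℕ and M_{n+1}/M_n is *-acyclic for every n ∈ ℕ, then M is *-acyclic, i.e. Ext^i_R(M, R) = 0 for all i ≥ 1. -/

import Mathlib

open CategoryTheory

/-- A left `R`-module `M` is `*`-acyclic if `Ext^i_R(M, R) = 0` for all `i ≥ 1`. -/
def StarAcyclic (R : Type) [Ring R] (M : Type) [AddCommGroup M] [Module R M] : Prop :=
  ∀ i : ℕ, 1 ≤ i →
    Subsingleton (((Ext ℤ (ModuleCat R) i).obj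
      (Opposite.op (ModuleCat.of R M))).obj (ModuleCat.of R R))

open Limits

theorem subsingleton_ext_iff {C : Type*} [Category* C] [Abelian C] [EnoughProjectives C]
    [HasExt C] (A : Type*) [Ring A] [Linear A C] (X Y : C) (n : ℕ) :
    Subsingleton (((Ext A C (n + 1)).obj (Opposite.op X)).obj Y) ↔
      Subsingleton (Abelian.Ext X Y (n + 1)) := by
  let P := projectiveResolution X
  have hcocycle : Subsingleton (Abelian.Ext X Y (n + 1)) ↔
      ∀ f : P.complex.X (n + 1) ⟶ Y, P.complex.d (n + 2) (n + 1) ≫ f = 0 →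
        ∃ g : P.complex.X n ⟶ Y, P.complex.d (n + 1) n ≫ g = f := by
    constructor
    · intro h f hf
      exact (P.extMk_eq_zero_iff f (n + 2) rfl hf n rfl).1 (Subsingleton.elim _ _)
    · intro h
      refine subsingleton_of_forall_eq 0 fun α => ?_
      obtain ⟨f, hf, rfl⟩ := P.extMk_surjective α (n + 2) rfl
      exact (P.extMk_eq_zero_iff f (n + 2) rfl hf n rfl).2 (h f hf)
  rw [hcocycle, ← ModuleCat.isZero_iff_subsingleton, (P.isoExt (n + 1) Y).isZero_iff,
    ← HomologicalComplex.exactAt_iff_isZero_homology,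
    HomologicalComplex.exactAt_iff' _ n (n + 1) (n + 2) (by simp) (by simp),
    ShortComplex.moduleCat_exact_iff]
  rfl

theorem starAcyclic_iff (R : Type) [Ring R] (M : Type) [AddCommGroup M] [Module R M] :
    StarAcyclic R M ↔
      ∀ i : ℕ, Subsingleton (Abelian.Ext (ModuleCat.of R M) (ModuleCat.of R R) (i + 1)) := by
  refine ⟨fun h i => (subsingleton_ext_iff ℤ _ _ _).1 (h (i + 1) (by omega)), fun h i hi => ?_⟩
  obtain ⟨i, rfl⟩ := Nat.exists_eq_add_of_le' hi
  exact (subsingleton_ext_iff ℤ _ _ _).2 (h i)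

namespace CategoryTheory.ShortComplex.ShortExact

variable {C : Type*} [Category* C] [Abelian C] [HasExt C] {S : ShortComplex C}

theorem exists_lift_of_subsingleton_ext (hS : S.ShortExact) {X : C}
    (hX : Subsingleton (Abelian.Ext X S.X₁ 1)) (f : X ⟶ S.X₃) :
    ∃ l : X ⟶ S.X₂, l ≫ S.g = f := by
  obtain ⟨y, hy⟩ := Abelian.Ext.covariant_sequence_exact₃ X hS (Abelian.Ext.mk₀ f) (zero_add 1)
    (Subsingleton.elim _ _)
  obtain ⟨l, rfl⟩ := (Abelian.Ext.mk₀_bijective X S.X₂).2 y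
  exact ⟨l, (Abelian.Ext.mk₀_bijective X S.X₃).1 (by rw [← hy, Abelian.Ext.mk₀_comp_mk₀])⟩

theorem exists_extension_of_subsingleton_ext (hS : S.ShortExact) {Y : C}
    (hY : Subsingleton (Abelian.Ext S.X₃ Y 1)) (f : S.X₁ ⟶ Y) :
    ∃ l : S.X₂ ⟶ Y, S.f ≫ l = f := by
  obtain ⟨y, hy⟩ := Abelian.Ext.contravariant_sequence_exact₁ hS Y (Abelian.Ext.mk₀ f) (add_zero 1)
    (Subsingleton.elim _ _)
  obtain ⟨l, rfl⟩ := (Abelian.Ext.mk₀_bijective S.X₂ Y).2 y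
  exact ⟨l, (Abelian.Ext.mk₀_bijective S.X₁ Y).1 (by rw [← hy, Abelian.Ext.mk₀_comp_mk₀])⟩

theorem subsingleton_ext_one_of_exists_lift (hS : S.ShortExact) [Injective S.X₂] {X : C}
    (h : ∀ f : X ⟶ S.X₃, ∃ l : X ⟶ S.X₂, l ≫ S.g = f) :
    Subsingleton (Abelian.Ext X S.X₁ 1) := by
  refine subsingleton_of_forall_eq 0 fun x => ?_
  obtain ⟨y, rfl⟩ := Abelian.Ext.covariant_sequence_exact₁ X hS x
    (Abelian.Ext.eq_zero_of_injective _) (zero_add 1)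
  obtain ⟨f, rfl⟩ := (Abelian.Ext.mk₀_bijective X S.X₃).2 y
  obtain ⟨l, rfl⟩ := h f
  rw [← Abelian.Ext.mk₀_comp_mk₀, Abelian.Ext.comp_assoc_of_second_deg_zero, hS.comp_extClass,
    Abelian.Ext.comp_zero]

theorem subsingleton_ext_succ_iff (hS : S.ShortExact) [Injective S.X₂] (X : C) (n : ℕ) :
    Subsingleton (Abelian.Ext X S.X₁ (n + 2)) ↔ Subsingleton (Abelian.Ext X S.X₃ (n + 1)) := by
  constructor
  · intro h
    refine subsingleton_of_forall_eq 0 fun x => ?_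
    obtain ⟨y, rfl⟩ := Abelian.Ext.covariant_sequence_exact₃ X hS x rfl (Subsingleton.elim _ _)
    rw [Abelian.Ext.eq_zero_of_injective y, Abelian.Ext.zero_comp]
  · intro h
    refine subsingleton_of_forall_eq 0 fun x => ?_
    obtain ⟨y, rfl⟩ := Abelian.Ext.covariant_sequence_exact₁ X hS x
      (Abelian.Ext.eq_zero_of_injective _) rfl
    rw [Subsingleton.elim y 0, Abelian.Ext.zero_comp]

end CategoryTheory.ShortComplex.ShortExact

namespace Submodule

variable {R : Type*} [Ring R] {M : Type*} [AddCommGroup M] [Module R M]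

/-- A compatible family of linear maps on an exhaustive chain of submodules glues. -/
theorem exists_linearMap_of_chain {P : Type*} [AddCommGroup P] [Module R P]
    {N : ℕ → Submodule R M} (hN : Monotone N) (hunion : ∀ x, ∃ n, x ∈ N n)
    (g : ∀ n, N n →ₗ[R] P)
    (hg : ∀ n x, g (n + 1) (inclusion (hN n.le_succ) x) = g n x) :
    ∃ f : M →ₗ[R] P, ∀ n (x : N n), f x = g n x := by
  have hle : ∀ n m (h : n ≤ m) (x : N n), g m (inclusion (hN h) x) = g n x := by
    intro n m h
    induction m, h using Nat.le_induction with
    | base => exact fun x => rfl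
    | succ m h ih => exact fun x => (hg m (inclusion (hN h) x)).trans (ih x)
  choose k hk using hunion
  have hind : ∀ n m (x : M) (hn : x ∈ N n) (hm : x ∈ N m), g n ⟨x, hn⟩ = g m ⟨x, hm⟩ := by
    intro n m x hn hm
    rw [← hle n _ (le_max_left n m), ← hle m _ (le_max_right n m)]
    rfl
  refine ⟨{ toFun := fun x => g (k x) ⟨x, hk x⟩, map_add' := fun x y => ?_,
            map_smul' := fun r x => ?_ }, fun n x => hind _ _ _ _ x.2⟩
  · let m := max (k x) (k y)
    have hx : x ∈ N m := hN (le_max_left _ _) (hk x)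
    have hy : y ∈ N m := hN (le_max_right _ _) (hk y)
    rw [hind _ m x _ hx, hind _ m y _ hy, hind _ m (x + y) _ (add_mem hx hy), ← map_add]
    rfl
  · rw [hind _ (k x) (r • x) _ (smul_mem _ r (hk x)), RingHom.id_apply, ← map_smul]
    rfl

end Submodule

namespace ModuleCat

universe u

variable {R : Type u} [Ring R] {M : Type u} [AddCommGroup M] [Module R M]

theorem exists_extension_of_subsingleton_ext {A B : Submodule R M} (hAB : A ≤ B)
    {Y : ModuleCat.{u} R}
    (h : Subsingleton (Abelian.Ext (of R (B ⧸ A.comap B.subtype)) Y 1)) (f : A →ₗ[R] Y) :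
    ∃ l : B →ₗ[R] Y, ∀ x, l (Submodule.inclusion hAB x) = f x := by
  let S : ShortComplex (ModuleCat.{u} R) :=
    ShortComplex.mk (ofHom (Submodule.inclusion hAB)) (ofHom (A.comap B.subtype).mkQ) (by
      ext x
      exact (Submodule.Quotient.mk_eq_zero _).2 x.2)
  have hS : S.ShortExact :=
    { exact := by
        rw [ShortComplex.moduleCat_exact_iff]
        intro x hx
        exact ⟨⟨x.1, (Submodule.Quotient.mk_eq_zero (A.comap B.subtype)).1 hx⟩, rfl⟩
      mono_f := (mono_iff_injective _).2 (Submodule.inclusion_injective hAB)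
      epi_g := (epi_iff_surjective _).2 (Submodule.mkQ_surjective _) }
  obtain ⟨l, hl⟩ := hS.exists_extension_of_subsingleton_ext h (ofHom f)
  exact ⟨l.hom, fun x => ConcreteCategory.congr_hom hl x⟩

variable {N : ℕ → Submodule R M}

theorem exists_lift_of_chain (hN : Monotone N) (hunion : ∀ x, ∃ n, x ∈ N n)
    {S : ShortComplex (ModuleCat.{u} R)} (hS : S.ShortExact)
    (hacyc : ∀ n, Subsingleton (Abelian.Ext (of R (N n)) S.X₁ 1))
    (hquot : ∀ n, Subsingleton
      (Abelian.Ext (of R (N (n + 1) ⧸ (N n).comap (N (n + 1)).subtype)) S.X₁ 1))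
    (f : of R M ⟶ S.X₃) : ∃ l : of R M ⟶ S.X₂, l ≫ S.g = f := by
  have hlift : ∀ n, ∃ g : N n →ₗ[R] S.X₂, ∀ x, S.g (g x) = f x.1 := fun n => by
    obtain ⟨l, hl⟩ := hS.exists_lift_of_subsingleton_ext (hacyc n) (ofHom (N n).subtype ≫ f)
    exact ⟨l.hom, fun x => ConcreteCategory.congr_hom hl x⟩
  have hstep : ∀ n (g : { g : N n →ₗ[R] S.X₂ // ∀ x, S.g (g x) = f x.1 }),
      ∃ g' : { g : N (n + 1) →ₗ[R] S.X₂ // ∀ x, S.g (g x) = f x.1 },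
        ∀ x, g'.1 (Submodule.inclusion (hN n.le_succ) x) = g.1 x := by
    rintro n ⟨g, hg⟩
    obtain ⟨h, hh⟩ := hlift (n + 1)
    let d : N n →ₗ[R] S.X₂ := g - h ∘ₗ Submodule.inclusion (hN n.le_succ)
    have hd : ofHom d ≫ S.g = 0 := by
      ext x
      change S.g (g x - h _) = 0
      rw [map_sub, hg, hh]
      exact sub_self _
    have := hS.mono_f
    let e := hS.exact.lift (ofHom d) hd
    have he : e ≫ S.f = ofHom d := hS.exact.lift_f _ _
    obtain ⟨e', he'⟩ := exists_extension_of_subsingleton_ext (hN n.le_succ) (hquot n) e.hom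
    refine ⟨⟨h + S.f.hom ∘ₗ e', fun x => ?_⟩, fun x => ?_⟩
    · have hz : S.g (S.f (e' x)) = 0 := ConcreteCategory.congr_hom S.zero (e' x)
      change S.g (h x + S.f (e' x)) = _
      rw [map_add, hh, hz, add_zero]
    · have hx : S.f (e x) = d x := ConcreteCategory.congr_hom he x
      change h _ + S.f (e' _) = g x
      rw [he']
      change h _ + S.f (e x) = g x
      rw [hx]
      exact add_sub_cancel _ _
  choose g₀ hg₀ using hlift 0
  choose next hnext using hstep
  let g : ∀ n, { g : N n →ₗ[R] S.X₂ // ∀ x, S.g (g x) = f x.1 } :=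
    fun n => Nat.rec ⟨g₀, hg₀⟩ next n
  obtain ⟨l, hl⟩ := Submodule.exists_linearMap_of_chain hN hunion (fun n => (g n).1)
    (fun n => hnext n (g n))
  refine ⟨ofHom l, ?_⟩
  ext x
  obtain ⟨n, hn⟩ := hunion x
  change S.g (l x) = f x
  rw [hl n ⟨x, hn⟩]
  exact (g n).2 ⟨x, hn⟩

theorem subsingleton_ext_of_chain (hN : Monotone N) (hunion : ∀ x, ∃ n, x ∈ N n)
    (i : ℕ) (Y : ModuleCat.{u} R)
    (hacyc : ∀ n j, Subsingleton (Abelian.Ext (of R (N n)) Y (j + 1)))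
    (hquot : ∀ n j, Subsingleton
      (Abelian.Ext (of R (N (n + 1) ⧸ (N n).comap (N (n + 1)).subtype)) Y (j + 1))) :
    Subsingleton (Abelian.Ext (of R M) Y (i + 1)) := by
  let S := ShortComplex.mk (Injective.ι Y) (cokernel.π (Injective.ι Y)) (cokernel.condition _)
  have hS : S.ShortExact := { exact := ShortComplex.exact_cokernel _ }
  have : Injective S.X₂ := inferInstanceAs (Injective (Injective.under Y))
  cases i with
  | zero =>
    exact hS.subsingleton_ext_one_of_exists_lift
      (exists_lift_of_chain hN hunion hS (fun n => hacyc n 0) (fun n => hquot n 0))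
  | succ i =>
    exact (hS.subsingleton_ext_succ_iff _ i).2 (subsingleton_ext_of_chain hN hunion i S.X₃
      (fun n j => (hS.subsingleton_ext_succ_iff _ j).1 (hacyc n (j + 1)))
      (fun n j => (hS.subsingleton_ext_succ_iff _ j).1 (hquot n (j + 1))))

end ModuleCat

/-- If `(Mₙ)` is an increasing chain of submodules of `M` with union
`M`, each `Mₙ` is `*`-acyclic and each `Mₙ₊₁/Mₙ` is `*`-acyclic, then `M` is
`*`-acyclic. -/
theorem statement17
    (R : Type) [Ring R] (M : Type) [AddCommGroup M] [Module R M]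
    (Mn : ℕ → Submodule R M) (hmono : Monotone Mn)
    (hunion : (⋃ n : ℕ, (Mn n : Set M)) = Set.univ)
    (hacyc : ∀ n : ℕ, StarAcyclic R (Mn n))
    (hquot : ∀ n : ℕ, StarAcyclic R ((Mn (n + 1)) ⧸ ((Mn n).comap (Mn (n + 1)).subtype))) :
    StarAcyclic R M := by
  simp only [starAcyclic_iff] at hacyc hquot ⊢
  have hmem (x : M) : ∃ n, x ∈ Mn n := by
    simpa using Set.eq_univ_iff_forall.1 hunion x
  exact fun i => ModuleCat.subsingleton_ext_of_chain hmono hmem i _ hacyc hquot
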